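/- arXiv:1809.04555 — 2 statements merged into one kernel-verified Lean document; each statement's English description precedes it below -/
import Mathlib

section
/- For every integer n ≥ 1, with m = 1, the matrix R is invertible and its 2-norm condition number satisfies κ₂(R) ≤ (n + 5/2)·(4·e^{1 + 7π²/8}·(2 + log n)). -/
open Real Finset

/-- `d_ℓ^m` from the Cholesky factor `R`. -/
noncomputable def dd (ℓ m : ℕ) : ℝ :=
  ((ℓ : ℝ) + m - 1) * Real.sqrt (((ℓ : ℝ) + m + 1) * ((ℓ : ℝ) + 2 * m) * ((ℓ : ℝ) + 2 * m + 1) /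
    (((ℓ : ℝ) + m) * (2 * (ℓ : ℝ) + 2 * m - 1) * (2 * (ℓ : ℝ) + 2 * m + 1)))

/-- `e_ℓ^m` from the Cholesky factor `R`. -/
noncomputable def ee (ℓ m : ℕ) : ℝ :=
  Real.sqrt ((ℓ : ℝ) * ((ℓ : ℝ) + 2 * m + 1) / (((ℓ : ℝ) + m) * ((ℓ : ℝ) + m + 1)))

/-- `f_ℓ^m` from the Cholesky factor `R`. -/
noncomputable def ff (ℓ m : ℕ) : ℝ :=
  ((ℓ : ℝ) + m + 2) * Real.sqrt ((ℓ : ℝ) * ((ℓ : ℝ) + 1) * ((ℓ : ℝ) + m) /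
    (((ℓ : ℝ) + m + 1) * (2 * (ℓ : ℝ) + 2 * m + 1) * (2 * (ℓ : ℝ) + 2 * m + 3)))

/-- The `n × n` upper-triangular banded matrix `R` with diagonal `d`, superdiagonal `-e`,
second superdiagonal `-f` (1-based indices shifted to 0-based `Fin n`). -/
noncomputable def Rmat (n m : ℕ) : Matrix (Fin n) (Fin n) ℝ :=
  Matrix.of fun i j : Fin n =>
    if (j : ℕ) = (i : ℕ) then dd ((i : ℕ) + 1) m
    else if (j : ℕ) = (i : ℕ) + 1 then -ee ((i : ℕ) + 1) m
    else if (j : ℕ) = (i : ℕ) + 2 then -ff ((i : ℕ) + 1) m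
    else 0

/-- The operator norm on square real matrices induced by the Euclidean norm on `ℝⁿ`. -/
noncomputable def opNorm2 {n : ℕ} (A : Matrix (Fin n) (Fin n) ℝ) : ℝ :=
  ‖Matrix.toEuclideanCLM (𝕜 := ℝ) A‖

theorem opNorm2_le_of_sum_sq_le {n : ℕ} (A : Matrix (Fin n) (Fin n) ℝ) {C : ℝ} (hC : 0 ≤ C)
    (h : ∀ v : Fin n → ℝ, ∑ i, (A.mulVec v) i ^ 2 ≤ C ^ 2 * ∑ i, v i ^ 2) : opNorm2 A ≤ C := by
  refine ContinuousLinearMap.opNorm_le_bound _ hC fun x => ?_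
  refine abs_le_of_sq_le_sq' ?_ (by positivity) |>.2
  rw [mul_pow, EuclideanSpace.real_norm_sq_eq, EuclideanSpace.real_norm_sq_eq]
  simpa [Matrix.ofLp_toEuclideanCLM] using h x.ofLp

/-- Extension of a finite vector by zero to a sequence. -/
noncomputable def zeroExtend {n : ℕ} (v : Fin n → ℝ) (k : ℕ) : ℝ :=
  if h : k < n then v ⟨k, h⟩ else 0

theorem zeroExtend_val {n : ℕ} (v : Fin n → ℝ) (i : Fin n) : zeroExtend v i = v i := by
  simp [zeroExtend]

theorem zeroExtend_of_le {n : ℕ} (v : Fin n → ℝ) {k : ℕ} (h : n ≤ k) : zeroExtend v k = 0 := by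
  simp [zeroExtend, Nat.not_lt.2 h]

theorem sum_eq_sum_range_zeroExtend {n : ℕ} (v : Fin n → ℝ) :
    ∑ i, v i ^ 2 = ∑ k ∈ range n, zeroExtend v k ^ 2 := by
  rw [← Fin.sum_univ_eq_sum_range (fun k => zeroExtend v k ^ 2)]
  simp only [zeroExtend_val]

theorem sum_ite_val_eq_mul {n : ℕ} (v : Fin n → ℝ) (k : ℕ) (c : ℝ) :
    ∑ j : Fin n, (if (j : ℕ) = k then c else 0) * v j = c * zeroExtend v k := by
  by_cases h : k < n
  · have : ∀ j : Fin n, ((j : ℕ) = k) = (j = ⟨k, h⟩) := fun j => by simp [Fin.ext_iff]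
    simp [this, zeroExtend, h]
  · have : ∀ j : Fin n, (j : ℕ) ≠ k := fun j hj => h (hj ▸ j.2)
    simp [this, zeroExtend, h]

theorem Rmat_mulVec {n : ℕ} (m : ℕ) (v : Fin n → ℝ) (i : Fin n) :
    (Rmat n m).mulVec v i = dd (i + 1) m * zeroExtend v i - ee (i + 1) m * zeroExtend v (i + 1)
      - ff (i + 1) m * zeroExtend v (i + 2) := by
  have hR : ∀ j : Fin n, Rmat n m i j * v j =
      (if (j : ℕ) = i then dd (i + 1) m else 0) * v j
        + (if (j : ℕ) = i + 1 then -ee (i + 1) m else 0) * v j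
        + (if (j : ℕ) = i + 2 then -ff (i + 1) m else 0) * v j := fun j => by
    simp only [Rmat, Matrix.of_apply]
    split_ifs <;> first | omega | ring
  rw [Matrix.mulVec, dotProduct]
  simp only [hR, Finset.sum_add_distrib, sum_ite_val_eq_mul]
  ring

theorem sum_range_shift_sq_le {n : ℕ} (v : Fin n → ℝ) (s : ℕ) :
    ∑ k ∈ range n, zeroExtend v (k + s) ^ 2 ≤ ∑ k ∈ range n, zeroExtend v k ^ 2 := by
  induction s with
  | zero => rfl
  | succ s ih =>
    refine le_trans ?_ ih
    have h := Finset.sum_range_succ' (fun k => zeroExtend v (k + s) ^ 2) n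
    rw [Finset.sum_range_succ, zeroExtend_of_le v (Nat.le_add_right n s)] at h
    simp only [add_right_comm _ 1 s] at h
    simp only [← add_assoc]
    linarith [sq_nonneg (zeroExtend v (0 + s))]

/-- A positive solution of the homogeneous recurrence `d x_ℓ = e x_{ℓ+1} + f x_{ℓ+2}` attached
to `R` for `m = 1`, at `ℓ = k + 1`. -/
noncomputable def kernelSol (k : ℕ) : ℝ :=
  Real.sqrt ((2 * (k : ℝ) + 3) / (((k : ℝ) + 1) * ((k : ℝ) + 2)))

theorem kernelSol_pos (k : ℕ) : 0 < kernelSol k := by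
  unfold kernelSol; positivity

theorem mul_sqrt_mul_sqrt_eq {a c X Y Z : ℝ} (ha : 0 ≤ a) (hc : 0 ≤ c) (hX : 0 ≤ X)
    (h : a ^ 2 * (X * Y) = c ^ 2 * Z) :
    a * Real.sqrt X * Real.sqrt Y = c * Real.sqrt Z := by
  rw [mul_assoc, ← Real.sqrt_mul hX, ← Real.sqrt_sq ha, ← Real.sqrt_sq hc,
    ← Real.sqrt_mul (sq_nonneg _), ← Real.sqrt_mul (sq_nonneg _), h]

theorem dd_mul_kernelSol (k : ℕ) : dd (k + 1) 1 * kernelSol k =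
    ((k : ℝ) + 3) / (k + 2) * Real.sqrt (((k : ℝ) + 1) * (k + 4) / (2 * k + 5)) := by
  unfold dd kernelSol
  push_cast
  rw [show (k : ℝ) + 1 + 1 - 1 = k + 1 by ring, show 2 * ((k : ℝ) + 1) + 2 * 1 - 1 = 2 * k + 3 by ring]
  apply mul_sqrt_mul_sqrt_eq <;> [positivity; positivity; positivity; skip]
  rw [show 2 * ((k : ℝ) + 1) + 2 * 1 + 1 = 2 * k + 5 by ring]
  field_simp
  ring

theorem ee_mul_kernelSol (k : ℕ) : ee (k + 1) 1 * kernelSol (k + 1) =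
    (2 * (k : ℝ) + 5) / ((k + 2) * (k + 3)) *
      Real.sqrt (((k : ℝ) + 1) * (k + 4) / (2 * k + 5)) := by
  unfold ee kernelSol
  push_cast
  rw [← one_mul (Real.sqrt ((_ * _) / _))]
  apply mul_sqrt_mul_sqrt_eq <;> [positivity; positivity; positivity; skip]
  field_simp
  ring

theorem ff_mul_kernelSol (k : ℕ) : ff (k + 1) 1 * kernelSol (k + 2) =
    ((k : ℝ) + 2) / (k + 3) * Real.sqrt (((k : ℝ) + 1) * (k + 4) / (2 * k + 5)) := by
  unfold ff kernelSol
  push_cast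
  apply mul_sqrt_mul_sqrt_eq <;> [positivity; positivity; positivity; skip]
  rw [show 2 * ((k : ℝ) + 1) + 2 * 1 + 1 = 2 * k + 5 by ring,
    show 2 * ((k : ℝ) + 1) + 2 * 1 + 3 = 2 * k + 7 by ring]
  field_simp
  ring

theorem kernelSol_recurrence (k : ℕ) : dd (k + 1) 1 * kernelSol k =
    ee (k + 1) 1 * kernelSol (k + 1) + ff (k + 1) 1 * kernelSol (k + 2) := by
  rw [dd_mul_kernelSol, ee_mul_kernelSol, ff_mul_kernelSol, ← add_mul]
  congr 1
  field_simp
  ring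

theorem dd_mul_kernelSol_pos (k : ℕ) : 0 < dd (k + 1) 1 * kernelSol k := by
  rw [dd_mul_kernelSol]; positivity

theorem dd_pos (k : ℕ) : 0 < dd (k + 1) 1 :=
  pos_of_mul_pos_left (dd_mul_kernelSol_pos k) (kernelSol_pos k).le

theorem ee_nonneg (ℓ m : ℕ) : 0 ≤ ee ℓ m := Real.sqrt_nonneg _

theorem ff_nonneg (ℓ m : ℕ) : 0 ≤ ff ℓ m := mul_nonneg (by positivity) (Real.sqrt_nonneg _)

theorem dd_le (k : ℕ) : dd (k + 1) 1 ≤ 2 * ((k : ℝ) + 1) := by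
  unfold dd
  push_cast
  rw [show (k : ℝ) + 1 + 1 - 1 = k + 1 by ring, mul_comm 2 ((k : ℝ) + 1),
    show ((k : ℝ) + 1) * 2 + 2 * 1 - 1 = 2 * k + 3 by ring]
  refine mul_le_mul_of_nonneg_left (Real.sqrt_le_iff.2 ⟨by norm_num, ?_⟩) (by positivity)
  rw [div_le_iff₀ (by positivity)]
  have hk : (0 : ℝ) ≤ k := Nat.cast_nonneg k
  nlinarith [pow_nonneg hk 3, pow_nonneg hk 2]

theorem ee_le (k : ℕ) : ee (k + 1) 1 ≤ 1 := by
  unfold ee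
  push_cast
  refine Real.sqrt_le_iff.2 ⟨by norm_num, ?_⟩
  rw [div_le_iff₀ (by positivity)]
  nlinarith

theorem ff_le (k : ℕ) : ff (k + 1) 1 ≤ (k : ℝ) + 4 := by
  unfold ff
  push_cast
  rw [show (k : ℝ) + 1 + 1 + 2 = k + 4 by ring]
  refine mul_le_of_le_one_right (by positivity) (Real.sqrt_le_iff.2 ⟨by norm_num, ?_⟩)
  rw [div_le_iff₀ (by positivity)]
  have hk : (0 : ℝ) ≤ k := Nat.cast_nonneg k
  nlinarith [pow_nonneg hk 3, pow_nonneg hk 2]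

theorem sq_sub_sub_le {a b c x y z M : ℝ} (ha : 0 ≤ a) (hb : 0 ≤ b) (hc : 0 ≤ c) (haM : a ≤ M)
    (hbM : b ≤ M) (hcM : c ≤ M) :
    (a * x - b * y - c * z) ^ 2 ≤ 3 * M ^ 2 * (x ^ 2 + y ^ 2 + z ^ 2) := by
  have h1 : a ^ 2 * x ^ 2 ≤ M ^ 2 * x ^ 2 := by gcongr
  have h2 : b ^ 2 * y ^ 2 ≤ M ^ 2 * y ^ 2 := by gcongr
  have h3 : c ^ 2 * z ^ 2 ≤ M ^ 2 * z ^ 2 := by gcongr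
  nlinarith [sq_nonneg (a * x + b * y), sq_nonneg (a * x + c * z), sq_nonneg (b * y - c * z)]

theorem opNorm2_Rmat_le (n : ℕ) : opNorm2 (Rmat n 1) ≤ 6 * ((n : ℝ) + 5 / 2) := by
  refine opNorm2_le_of_sum_sq_le _ (by positivity) fun v => ?_
  have hrow : ∀ k ∈ range n, (dd (k + 1) 1 * zeroExtend v k - ee (k + 1) 1 * zeroExtend v (k + 1)
      - ff (k + 1) 1 * zeroExtend v (k + 2)) ^ 2 ≤ 3 * (2 * ((n : ℝ) + 5 / 2)) ^ 2 *
        (zeroExtend v k ^ 2 + zeroExtend v (k + 1) ^ 2 + zeroExtend v (k + 2) ^ 2) := by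
    intro k hk
    have hkn : (k : ℝ) + 1 ≤ n := by exact_mod_cast Finset.mem_range.1 hk
    have hk0 : (0 : ℝ) ≤ k := Nat.cast_nonneg k
    exact sq_sub_sub_le (dd_pos k).le (ee_nonneg _ _) (ff_nonneg _ _)
      ((dd_le k).trans (by linarith)) ((ee_le k).trans (by linarith))
      ((ff_le k).trans (by linarith))
  have h := Finset.sum_le_sum hrow
  rw [← Finset.mul_sum, Finset.sum_add_distrib, Finset.sum_add_distrib] at h
  rw [sum_eq_sum_range_zeroExtend v]
  simp only [Rmat_mulVec]
  rw [Fin.sum_univ_eq_sum_range (fun k => (dd (k + 1) 1 * zeroExtend v k -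
    ee (k + 1) 1 * zeroExtend v (k + 1) - ff (k + 1) 1 * zeroExtend v (k + 2)) ^ 2)]
  refine h.trans ?_
  have h1 := sum_range_shift_sq_le v 1
  have h2 := sum_range_shift_sq_le v 2
  calc _ ≤ 3 * (2 * ((n : ℝ) + 5 / 2)) ^ 2 * (∑ k ∈ range n, zeroExtend v k ^ 2 +
        ∑ k ∈ range n, zeroExtend v k ^ 2 + ∑ k ∈ range n, zeroExtend v k ^ 2) := by gcongr
    _ = _ := by ring

/-- Tails of the majorant of `R⁻¹ w`. -/
noncomputable def tailSum {n : ℕ} (w : Fin n → ℝ) (k : ℕ) : ℝ :=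
  ∑ j ∈ Ico k n, |zeroExtend w j| / (dd (j + 1) 1 * kernelSol j)

theorem tailSum_nonneg {n : ℕ} (w : Fin n → ℝ) (k : ℕ) : 0 ≤ tailSum w k :=
  Finset.sum_nonneg fun j _ => div_nonneg (abs_nonneg _) (dd_mul_kernelSol_pos j).le

theorem tailSum_antitone {n : ℕ} (w : Fin n → ℝ) : Antitone (tailSum w) := fun _ _ h =>
  Finset.sum_le_sum_of_subset_of_nonneg (Finset.Ico_subset_Ico_left h) fun j _ _ =>
    div_nonneg (abs_nonneg _) (dd_mul_kernelSol_pos j).le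

theorem abs_zeroExtend_le {n : ℕ} (v : Fin n → ℝ) (k : ℕ) :
    |zeroExtend v k| ≤ kernelSol k * tailSum ((Rmat n 1).mulVec v) k := by
  set w := (Rmat n 1).mulVec v with hw
  obtain hk | hk := le_or_gt n k
  · rw [zeroExtend_of_le v hk, abs_zero]
    exact mul_nonneg (kernelSol_pos k).le (tailSum_nonneg w k)
  have ih1 := abs_zeroExtend_le v (k + 1)
  have ih2 := abs_zeroExtend_le v (k + 2)
  rw [← hw] at ih1 ih2
  have ht : tailSum w k =
      |zeroExtend w k| / (dd (k + 1) 1 * kernelSol k) + tailSum w (k + 1) :=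
    Finset.sum_eq_sum_Ico_succ_bot hk _
  have hd := dd_pos k
  have hu := kernelSol_pos k
  have hwk : zeroExtend w k = dd (k + 1) 1 * zeroExtend v k - ee (k + 1) 1 * zeroExtend v (k + 1)
      - ff (k + 1) 1 * zeroExtend v (k + 2) := by
    rw [← Rmat_mulVec 1 v ⟨k, hk⟩, ← hw, ← zeroExtend_val w]
  refine le_of_mul_le_mul_left ?_ hd
  calc dd (k + 1) 1 * |zeroExtend v k|
      = |zeroExtend w k + ee (k + 1) 1 * zeroExtend v (k + 1)
          + ff (k + 1) 1 * zeroExtend v (k + 2)| := by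
        rw [hwk, ← abs_of_pos hd, ← abs_mul, abs_of_pos hd]; congr 1; ring
    _ ≤ |zeroExtend w k| + ee (k + 1) 1 * |zeroExtend v (k + 1)|
          + ff (k + 1) 1 * |zeroExtend v (k + 2)| := by
        refine (abs_add_three _ _ _).trans_eq ?_
        rw [abs_mul, abs_mul, abs_of_nonneg (ee_nonneg _ _), abs_of_nonneg (ff_nonneg _ _)]
    _ ≤ |zeroExtend w k| + ee (k + 1) 1 * (kernelSol (k + 1) * tailSum w (k + 1))
          + ff (k + 1) 1 * (kernelSol (k + 2) * tailSum w (k + 1)) := by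
        have := (kernelSol_pos (k + 2)).le
        have := ee_nonneg (k + 1) 1
        have := ff_nonneg (k + 1) 1
        gcongr
        exact ih2.trans (by gcongr; exact tailSum_antitone w (by omega))
    _ = |zeroExtend w k| + dd (k + 1) 1 * kernelSol k * tailSum w (k + 1) := by
        rw [kernelSol_recurrence]; ring
    _ = dd (k + 1) 1 * (kernelSol k * tailSum w k) := by
        rw [ht]; field_simp
termination_by n - k

theorem kernelSol_sq_le (k : ℕ) : kernelSol k ^ 2 ≤ 2 * ((k + 1 : ℕ) : ℝ)⁻¹ := by
  unfold kernelSol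
  rw [Real.sq_sqrt (by positivity), div_le_iff₀ (by positivity)]
  push_cast
  field_simp
  linarith

theorem inv_dd_mul_kernelSol_sq_le (k : ℕ) :
    (dd (k + 1) 1 * kernelSol k)⁻¹ ^ 2 ≤ 2 * ((k + 1 : ℕ) : ℝ)⁻¹ := by
  rw [dd_mul_kernelSol, inv_pow, mul_pow, Real.sq_sqrt (by positivity)]
  refine inv_le_of_inv_le₀ (by positivity) ?_
  push_cast
  rw [mul_inv, inv_inv, div_pow, div_mul_div_comm, le_div_iff₀ (by positivity)]
  have hk : (0 : ℝ) ≤ k := Nat.cast_nonneg k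
  nlinarith [pow_nonneg hk 3, pow_nonneg hk 2, pow_nonneg hk 4]

theorem sum_inv_le_one_add_log (n : ℕ) :
    ∑ k ∈ range n, ((k + 1 : ℕ) : ℝ)⁻¹ ≤ 1 + Real.log n := by
  simpa [harmonic] using harmonic_le_one_add_log n

theorem tailSum_sq_le {n : ℕ} (w : Fin n → ℝ) (k : ℕ) :
    tailSum w k ^ 2 ≤ 2 * (1 + Real.log n) * ∑ i, w i ^ 2 := by
  have h0 : tailSum w k ^ 2 ≤ tailSum w 0 ^ 2 :=
    pow_le_pow_left₀ (tailSum_nonneg w k) (tailSum_antitone w (Nat.zero_le k)) 2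
  refine h0.trans ?_
  have h := Finset.sum_mul_sq_le_sq_mul_sq (range n) (fun j => (dd (j + 1) 1 * kernelSol j)⁻¹)
    (fun j => |zeroExtend w j|)
  have h1 : ∑ j ∈ range n, (dd (j + 1) 1 * kernelSol j)⁻¹ ^ 2 ≤ 2 * (1 + Real.log n) :=
    (Finset.sum_le_sum fun j _ => inv_dd_mul_kernelSol_sq_le j).trans (by
      rw [← Finset.mul_sum]; linarith [sum_inv_le_one_add_log n])
  simp only [sq_abs] at h
  rw [← sum_eq_sum_range_zeroExtend w] at h
  unfold tailSum
  simp only [div_eq_inv_mul, ← Finset.range_eq_Ico]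
  exact h.trans (mul_le_mul_of_nonneg_right h1 (Finset.sum_nonneg fun _ _ => sq_nonneg _))

theorem sum_sq_le_sum_Rmat_mulVec_sq {n : ℕ} (v : Fin n → ℝ) :
    ∑ i, v i ^ 2 ≤ (2 * (1 + Real.log n)) ^ 2 * ∑ i, ((Rmat n 1).mulVec v) i ^ 2 := by
  set w := (Rmat n 1).mulVec v with hw
  have hlog : 0 ≤ Real.log n := Real.log_natCast_nonneg n
  have hw0 : 0 ≤ ∑ i, w i ^ 2 := Finset.sum_nonneg fun _ _ => sq_nonneg _
  rw [sum_eq_sum_range_zeroExtend v]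
  calc ∑ k ∈ range n, zeroExtend v k ^ 2
      ≤ ∑ k ∈ range n, 2 * ((k + 1 : ℕ) : ℝ)⁻¹ * (2 * (1 + Real.log n) * ∑ i, w i ^ 2) := by
        refine Finset.sum_le_sum fun k _ => ?_
        rw [← sq_abs]
        calc |zeroExtend v k| ^ 2 ≤ (kernelSol k * tailSum w k) ^ 2 :=
              pow_le_pow_left₀ (abs_nonneg _) (abs_zeroExtend_le v k) 2
          _ = kernelSol k ^ 2 * tailSum w k ^ 2 := mul_pow _ _ _
          _ ≤ _ := mul_le_mul (kernelSol_sq_le k) (tailSum_sq_le w k) (sq_nonneg _)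
                (by positivity)
    _ = 2 * (∑ k ∈ range n, ((k + 1 : ℕ) : ℝ)⁻¹) * (2 * (1 + Real.log n) * ∑ i, w i ^ 2) := by
        rw [← Finset.sum_mul, ← Finset.mul_sum]
    _ ≤ 2 * (1 + Real.log n) * (2 * (1 + Real.log n) * ∑ i, w i ^ 2) := by
        gcongr
        exact sum_inv_le_one_add_log n
    _ = _ := by ring

theorem isUnit_Rmat (n : ℕ) : IsUnit (Rmat n 1) := by
  rw [← Matrix.mulVec_injective_iff_isUnit, ← Matrix.coe_mulVecLin, ← LinearMap.ker_eq_bot,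
    LinearMap.ker_eq_bot']
  intro v hv
  rw [Matrix.mulVecLin_apply] at hv
  have h := sum_sq_le_sum_Rmat_mulVec_sq v
  simp only [hv, Pi.zero_apply, ne_eq, OfNat.ofNat_ne_zero, not_false_eq_true, zero_pow,
    Finset.sum_const_zero, mul_zero] at h
  funext i
  have := (Finset.single_le_sum (fun j _ => sq_nonneg (v j)) (Finset.mem_univ i)).trans h
  exact pow_eq_zero_iff two_ne_zero |>.1 (le_antisymm this (sq_nonneg _))

theorem opNorm2_Rmat_inv_le (n : ℕ) : opNorm2 (Rmat n 1)⁻¹ ≤ 2 * (1 + Real.log n) := by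
  have hlog : 0 ≤ Real.log n := Real.log_natCast_nonneg n
  refine opNorm2_le_of_sum_sq_le _ (by positivity) fun v => ?_
  have h := sum_sq_le_sum_Rmat_mulVec_sq ((Rmat n 1)⁻¹.mulVec v)
  rwa [Matrix.mulVec_mulVec, Matrix.mul_nonsing_inv _ ((Matrix.isUnit_iff_isUnit_det _).1
    (isUnit_Rmat n)), Matrix.one_mulVec] at h

theorem stmt1 (n : ℕ) (hn : 1 ≤ n) :
    IsUnit (Rmat n 1) ∧
      opNorm2 (Rmat n 1) * opNorm2 (Rmat n 1)⁻¹ ≤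
        ((n : ℝ) + 5 / 2) * (4 * Real.exp (1 + 7 * Real.pi ^ 2 / 8) * (2 + Real.log n)) := by
  refine ⟨isUnit_Rmat n, ?_⟩
  have hlog : 0 ≤ Real.log n := Real.log_natCast_nonneg n
  have hexp : 3 ≤ Real.exp (1 + 7 * Real.pi ^ 2 / 8) := by
    have := Real.add_one_le_exp (1 + 7 * Real.pi ^ 2 / 8)
    nlinarith [Real.pi_gt_three]
  calc opNorm2 (Rmat n 1) * opNorm2 (Rmat n 1)⁻¹
      ≤ 6 * ((n : ℝ) + 5 / 2) * (2 * (1 + Real.log n)) :=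
        mul_le_mul (opNorm2_Rmat_le n) (opNorm2_Rmat_inv_le n) (norm_nonneg _) (by positivity)
    _ = ((n : ℝ) + 5 / 2) * (4 * 3 * (1 + Real.log n)) := by ring
    _ ≤ _ := by
        gcongr
        norm_num
end

section
/- For every integer m ≥ 2 and every positive integer ℓ, the row sum satisfies d_ℓ^m − e_ℓ^m − f_ℓ^m ≥ m − 3/2. -/
open Real Finset

/-- Lower bound for the `m`-independent factor of the diagonal entries. -/
theorem le_sqrt_diagonal_factor {x : ℝ} (hx : 3 ≤ x) :
    (2 * x ^ 3 - x ^ 2 - x - 1) / (4 * x ^ 3) ≤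
      √((x - 1) ^ 2 * (x + 1) / (x * (2 * x - 1) * (2 * x + 1))) := by
  obtain ⟨s, rfl⟩ : ∃ s, x = s + 3 := ⟨x - 3, by ring⟩
  have hs : 0 ≤ s := by linarith
  have h₁ : 0 < 2 * (s + 3) - 1 := by linarith
  apply Real.le_sqrt_of_sq_le
  rw [div_pow, div_le_div_iff₀ (by positivity) (by positivity), ← sub_nonneg]
  ring_nf
  positivity

/-- Upper bound for the `m`-independent factor of the second superdiagonal entries. -/
theorem sqrt_superdiagonal_factor_le {x : ℝ} (hx : 3 ≤ x) :
    √((x + 2) ^ 2 * x / ((x + 1) * (2 * x + 1) * (2 * x + 3))) ≤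
      (2 * x ^ 3 + x ^ 2 - 2 * x + 4) / (4 * x ^ 3) := by
  obtain ⟨s, rfl⟩ : ∃ s, x = s + 3 := ⟨x - 3, by ring⟩
  have hs : 0 ≤ s := by linarith
  have h₁ : 0 ≤ 2 * (s + 3) ^ 3 + (s + 3) ^ 2 - 2 * (s + 3) + 4 := by
    ring_nf
    positivity
  refine Real.sqrt_le_iff.2 ⟨by positivity, ?_⟩
  rw [div_pow, div_le_div_iff₀ (by positivity) (by positivity), ← sub_nonneg]
  ring_nf
  positivity

theorem le_sqrt_sq_sub_quarter {t : ℝ} (ht : 1 ≤ t) :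
    t * (8 * t ^ 2 - 2) / (8 * t ^ 2 - 1) ≤ √(t ^ 2 - 1 / 4) := by
  have h₁ : 0 < 8 * t ^ 2 - 1 := by nlinarith
  apply Real.le_sqrt_of_sq_le
  rw [div_pow, div_le_iff₀ (by positivity)]
  nlinarith

theorem sqrt_sq_sub_quarter_le {u : ℝ} (hu : 1 ≤ u) :
    √(u ^ 2 - 1 / 4) ≤ (8 * u ^ 2 - 1) / (8 * u) := by
  have h₁ : 0 < 8 * u ^ 2 - 1 := by nlinarith
  refine Real.sqrt_le_iff.2 ⟨by positivity, ?_⟩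
  rw [div_pow, le_div_iff₀ (by positivity)]
  nlinarith

theorem le_dd {ℓ m : ℕ} (hℓ : 1 ≤ ℓ) (hm : 2 ≤ m) {x t : ℝ}
    (hx : x = ℓ + m) (ht : t = ℓ + 2 * m + 1 / 2) :
    (2 * x ^ 3 - x ^ 2 - x - 1) / (4 * x ^ 3) * (t * (8 * t ^ 2 - 2) / (8 * t ^ 2 - 1)) ≤
      dd ℓ m := by
  have hℓ' : (1 : ℝ) ≤ ℓ := by exact_mod_cast hℓ
  have hm' : (2 : ℝ) ≤ m := by exact_mod_cast hm
  have hx₃ : 3 ≤ x := by linarith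
  have ht₁ : 1 ≤ t := by linarith
  have h₁ : 0 < 2 * x - 1 := by linarith
  have h₂ : 0 ≤ t * (8 * t ^ 2 - 2) / (8 * t ^ 2 - 1) :=
    div_nonneg (mul_nonneg (by linarith) (by nlinarith)) (by nlinarith)
  have hdd : dd ℓ m =
      √((x - 1) ^ 2 * (x + 1) / (x * (2 * x - 1) * (2 * x + 1))) * √(t ^ 2 - 1 / 4) := by
    rw [← Real.sqrt_mul (by positivity), dd, ← hx]
    nth_rewrite 1 [← Real.sqrt_sq (show 0 ≤ x - 1 by linarith)]
    rw [← Real.sqrt_mul (by positivity)]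
    congr 1
    rw [show 2 * (ℓ : ℝ) + 2 * m = 2 * x by rw [hx]; ring,
      show t ^ 2 - 1 / 4 = ((ℓ : ℝ) + 2 * m) * ((ℓ : ℝ) + 2 * m + 1) by rw [ht]; ring]
    ring
  rw [hdd]
  exact mul_le_mul (le_sqrt_diagonal_factor hx₃) (le_sqrt_sq_sub_quarter ht₁) h₂
    (Real.sqrt_nonneg _)

theorem ff_le_s6 {ℓ m : ℕ} (hℓ : 1 ≤ ℓ) (hm : 2 ≤ m) {x u : ℝ}
    (hx : x = ℓ + m) (hu : u = ℓ + 1 / 2) :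
    ff ℓ m ≤ (2 * x ^ 3 + x ^ 2 - 2 * x + 4) / (4 * x ^ 3) * ((8 * u ^ 2 - 1) / (8 * u)) := by
  have hℓ' : (1 : ℝ) ≤ ℓ := by exact_mod_cast hℓ
  have hm' : (2 : ℝ) ≤ m := by exact_mod_cast hm
  have hx₃ : 3 ≤ x := by linarith
  have hu₁ : 1 ≤ u := by linarith
  have hff : ff ℓ m =
      √((x + 2) ^ 2 * x / ((x + 1) * (2 * x + 1) * (2 * x + 3))) * √(u ^ 2 - 1 / 4) := by
    rw [← Real.sqrt_mul (by positivity), ff, ← hx]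
    nth_rewrite 1 [← Real.sqrt_sq (show 0 ≤ x + 2 by linarith)]
    rw [← Real.sqrt_mul (by positivity)]
    congr 1
    rw [show 2 * (ℓ : ℝ) + 2 * m = 2 * x by rw [hx]; ring,
      show u ^ 2 - 1 / 4 = (ℓ : ℝ) * ((ℓ : ℝ) + 1) by rw [hu]; ring]
    ring
  rw [hff]
  exact mul_le_mul (sqrt_superdiagonal_factor_le hx₃) (sqrt_sq_sub_quarter_le hu₁)
    (Real.sqrt_nonneg _) ((Real.sqrt_nonneg _).trans (sqrt_superdiagonal_factor_le hx₃))

theorem ee_le_s6 {ℓ m : ℕ} (hℓ : 1 ≤ ℓ) {x : ℝ} (hx : x = ℓ + m) :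
    ee ℓ m ≤ 1 - (m : ℝ) * (m + 1) / (2 * x * (x + 1)) := by
  have hℓ' : (1 : ℝ) ≤ ℓ := by exact_mod_cast hℓ
  have hx₁ : 0 < x := by rw [hx]; positivity
  have h := Real.sqrt_one_add_le (x := -((m : ℝ) * (m + 1) / (x * (x + 1)))) (by
    rw [neg_le_neg_iff, div_le_one (by positivity), hx]
    nlinarith [(Nat.cast_nonneg m : (0 : ℝ) ≤ m)])
  rw [ee, ← hx]
  convert h using 2
  · rw [← sub_eq_zero]
    field_simp
    rw [hx]
    ring
  · field_simp
    ring

/-- The row-sum inequality for the rational bounds of the three entries. -/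
theorem rational_row_sum_bound {s p : ℝ} (hs : 0 ≤ s) (hp : 0 ≤ p) {x t u : ℝ}
    (hx : x = s + p + 3) (ht : t = s + 2 * p + 11 / 2) (hu : u = s + 3 / 2) :
    p + 2 - 3 / 2 ≤
      (2 * x ^ 3 - x ^ 2 - x - 1) / (4 * x ^ 3) * (t * (8 * t ^ 2 - 2) / (8 * t ^ 2 - 1)) -
        (1 - (p + 2) * (p + 2 + 1) / (2 * x * (x + 1))) -
        (2 * x ^ 3 + x ^ 2 - 2 * x + 4) / (4 * x ^ 3) * ((8 * u ^ 2 - 1) / (8 * u)) := by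
  have hx₀ : 0 < x := by rw [hx]; positivity
  have hu₀ : 0 < u := by rw [hu]; positivity
  have ht₀ : 0 < 8 * t ^ 2 - 1 := by
    rw [ht]
    ring_nf
    positivity
  have key : 0 ≤
      8 * u * (x + 1) * (2 * x ^ 3 - x ^ 2 - x - 1) * t * (8 * t ^ 2 - 2) +
        16 * u * x ^ 2 * (p + 2) * (p + 3) * (8 * t ^ 2 - 1) -
        (x + 1) * (2 * x ^ 3 + x ^ 2 - 2 * x + 4) * (8 * u ^ 2 - 1) * (8 * t ^ 2 - 1) -
        32 * u * x ^ 3 * (x + 1) * (8 * t ^ 2 - 1) * (p + 3 / 2) := by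
    rw [hx, ht, hu]
    ring_nf
    positivity
  rw [← sub_nonneg]
  refine (div_nonneg key (show 0 ≤ 32 * u * x ^ 3 * (x + 1) * (8 * t ^ 2 - 1) by
    positivity)).trans_eq ?_
  have ht₁ := ht₀.ne'
  field_simp
  ring

theorem stmt6 (ℓ m : ℕ) (hℓ : 1 ≤ ℓ) (hm : 2 ≤ m) :
    dd ℓ m - ee ℓ m - ff ℓ m ≥ (m : ℝ) - 3 / 2 := by
  have hs : (0 : ℝ) ≤ ℓ - 1 := by simpa using hℓ
  have hp : (0 : ℝ) ≤ m - 2 := by simpa using hm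
  have hd := le_dd hℓ hm rfl rfl
  have he := ee_le_s6 (m := m) hℓ rfl
  have hf := ff_le_s6 hℓ hm rfl rfl
  have h := rational_row_sum_bound hs hp (x := ℓ + m) (t := ℓ + 2 * m + 1 / 2) (u := ℓ + 1 / 2)
    (by ring) (by ring) (by ring)
  rw [sub_add_cancel] at h
  linarith
end
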